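/- Let u_i ≤ M ∈ ℝ, i = 1, 2, …, be functions on X with p-weak upper gradients g_i. Let u = sup_i u_i and g = sup_i g_i. Then g is a p-weak upper gradient of u. -/

import Mathlib

open MeasureTheory Metric Set Filter
open scoped ENNReal NNReal Topology

noncomputable section

variable {X : Type*} [MetricSpace X] [MeasurableSpace X] [BorelSpace X]

/-- A nonconstant, compact, rectifiable curve in `X`, parameterized by arc length on
`[0, len]`. The arc-length parameterization is expressed by requiring that the length
(total variation) of the curve on each subinterval `[s, t]` equals `t - s`. -/
structure Curve (X : Type*) [MetricSpace X] where
  len : ℝ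
  len_pos : 0 < len
  toFun : ℝ → X
  continuousOn : ContinuousOn toFun (Set.Icc 0 len)
  arclength : ∀ s t : ℝ, s ∈ Set.Icc 0 len → t ∈ Set.Icc 0 len → s ≤ t →
    eVariationOn toFun (Set.Icc s t) = ENNReal.ofReal (t - s)
  nonconstant : ∃ s ∈ Set.Icc 0 len, ∃ t ∈ Set.Icc 0 len, toFun s ≠ toFun t

/-- The curve integral `∫_γ g ds` of a nonnegative function along an arc-length
parameterized curve. -/
def Curve.integral (γ : Curve X) (g : X → ℝ≥0∞) : ℝ≥0∞ :=
  ∫⁻ t in Set.Icc (0 : ℝ) γ.len, g (γ.toFun t)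

/-- `|a - b|` with the convention that it is `∞` whenever both `a` and `b` are infinite. -/
def ugDiff (a b : EReal) : ℝ≥0∞ :=
  if a.abs = ⊤ ∨ b.abs = ⊤ then ⊤ else (a - b).abs

/-- The upper gradient inequality for `f` and `g` along the curve `γ`. -/
def UGOn (f : X → EReal) (g : X → ℝ≥0∞) (γ : Curve X) : Prop :=
  ugDiff (f (γ.toFun 0)) (f (γ.toFun γ.len)) ≤ γ.integral g

/-- A curve family has zero `p`-modulus. -/
def ZeroModulus (p : ℝ) (μ : Measure X) (Γ : Set (Curve X)) : Prop :=
  ∃ ρ : X → ℝ≥0∞, Measurable ρ ∧ (∫⁻ x, ρ x ^ p ∂μ) < ⊤ ∧ ∀ γ ∈ Γ, γ.integral ρ = ⊤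

/-- `g` is an upper gradient of `f`. -/
def IsUpperGradient (f : X → EReal) (g : X → ℝ≥0∞) : Prop :=
  Measurable g ∧ ∀ γ : Curve X, UGOn f g γ

/-- `g` is a `p`-weak upper gradient of `f`: the upper gradient inequality holds for
`p`-almost every curve. -/
def IsWeakUpperGradient (p : ℝ) (μ : Measure X) (f : X → EReal) (g : X → ℝ≥0∞) : Prop :=
  Measurable g ∧ ZeroModulus p μ {γ : Curve X | ¬ UGOn f g γ}

/-- The energy `∫_X g_u^p dμ` of the minimal `p`-weak upper gradient of `u`, expressed as
the infimum of `∫_X g^p dμ` over all `p`-weak upper gradients `g` of `u`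
(`= ∞` if `u` has no `p`-weak upper gradient). -/
def gradEnergy (p : ℝ) (μ : Measure X) (u : X → EReal) : ℝ≥0∞ :=
  ⨅ (g : X → ℝ≥0∞) (_ : IsWeakUpperGradient p μ u g), ∫⁻ x, g x ^ p ∂μ

/-- The Newtonian energy `‖u‖_{N^{1,p}(X)}^p = ∫_X |u|^p dμ + ∫_X g_u^p dμ`. -/
def newtonianEnergy (p : ℝ) (μ : Measure X) (u : X → EReal) : ℝ≥0∞ :=
  (∫⁻ x, (u x).abs ^ p ∂μ) + gradEnergy p μ u

/-- Membership in the Newtonian space `N^{1,p}(X)` (measurability is with respect to the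
completion of the Borel σ-algebra, i.e. a.e.-measurability). -/
def MemNewtonian (p : ℝ) (μ : Measure X) (u : X → EReal) : Prop :=
  AEMeasurable u μ ∧ newtonianEnergy p μ u < ⊤

/-- Membership in `N^{1,p}_0(E)`, members being regarded as functions on all of `X`
that vanish outside `E`. -/
def MemNewtonian0 (p : ℝ) (μ : Measure X) (E : Set X) (u : X → EReal) : Prop :=
  MemNewtonian p μ u ∧ ∀ x ∉ E, u x = 0

/-- The Sobolev capacity `C_p(A)`. -/
def sobolevCapacity (p : ℝ) (μ : Measure X) (A : Set X) : ℝ≥0∞ :=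
  ⨅ (u : X → EReal) (_ : MemNewtonian p μ u ∧ ∀ x ∈ A, u x = 1), newtonianEnergy p μ u

/-- The variational capacity `cap_p(A, E)`. -/
def varCapacity (p : ℝ) (μ : Measure X) (A E : Set X) : ℝ≥0∞ :=
  ⨅ (u : X → EReal) (_ : MemNewtonian0 p μ E u ∧ ∀ x ∈ A, 1 ≤ u x), gradEnergy p μ u

/-- A function is quasicontinuous if outside open sets of arbitrarily small Sobolev
capacity it is real-valued and continuous. -/
def QuasicontinuousFun (p : ℝ) (μ : Measure X) (u : X → EReal) : Prop :=
  ∀ ε : ℝ≥0∞, 0 < ε → ∃ G : Set X, IsOpen G ∧ sobolevCapacity p μ G < ε ∧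
    (∀ x ∈ Gᶜ, u x ≠ ⊤ ∧ u x ≠ ⊥) ∧ ContinuousOn u Gᶜ

/-- The capacity `~cap_p(A,E)`: the infimum of `cap_p(G,E)` over all relatively open
subsets `G` of `E` containing `A`. -/
def varCapacityT (p : ℝ) (μ : Measure X) (A E : Set X) : ℝ≥0∞ :=
  ⨅ (G : Set X) (_ : A ⊆ G ∧ G ⊆ E ∧ ∃ U : Set X, IsOpen U ∧ G = U ∩ E),
    varCapacity p μ G E


theorem ugDiff_coe (a b : ℝ) : ugDiff a b = ENNReal.ofReal |a - b| := by
  rw [ugDiff, if_neg (by simp [(EReal.abs_coe_lt_top _).ne]), ← EReal.coe_sub, EReal.abs_def]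

theorem exists_coe_of_ugDiff_ne_top {a b : EReal} (h : ugDiff a b ≠ ⊤) :
    ∃ x y : ℝ, a = x ∧ b = y := by
  induction a <;> induction b <;> simp_all [ugDiff]

theorem ugDiff_iSup_le {ι : Type*} [Nonempty ι] {a b : ι → EReal} {c : ℝ≥0∞}
    (ha : ⨆ i, a i ≠ ⊤) (hb : ⨆ i, b i ≠ ⊤) (h : ∀ i, ugDiff (a i) (b i) ≤ c) :
    ugDiff (⨆ i, a i) (⨆ i, b i) ≤ c := by
  rcases eq_or_ne c ⊤ with rfl | hc
  · exact le_top
  choose x y hx hy using fun i => exists_coe_of_ugDiff_ne_top ((h i).trans_lt hc.lt_top).ne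
  obtain ⟨i₀⟩ := ‹Nonempty ι›
  have ha' : ⨆ i, a i ≠ ⊥ := fun h0 => by simpa [hx] using iSup_eq_bot.mp h0 i₀
  have hb' : ⨆ i, b i ≠ ⊥ := fun h0 => by simpa [hy] using iSup_eq_bot.mp h0 i₀
  have hxA : ∀ i, (x i : EReal) ≤ ⨆ i, a i := fun i => hx i ▸ le_iSup a i
  have hyB : ∀ i, (y i : EReal) ≤ ⨆ i, b i := fun i => hy i ▸ le_iSup b i
  have hA : ∀ t : ℝ, (∀ i, x i ≤ t) → ⨆ i, a i ≤ (t : EReal) := fun t ht =>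
    iSup_le fun i => by rw [hx]; exact_mod_cast ht i
  have hB : ∀ t : ℝ, (∀ i, y i ≤ t) → ⨆ i, b i ≤ (t : EReal) := fun t ht =>
    iSup_le fun i => by rw [hy]; exact_mod_cast ht i
  have hxy : ∀ i, |x i - y i| ≤ c.toReal := fun i => by
    have := h i
    rwa [hx, hy, ugDiff_coe, ENNReal.ofReal_le_iff_le_toReal hc] at this
  generalize (⨆ i, a i) = A at *
  generalize (⨆ i, b i) = B at *
  lift A to ℝ using ⟨ha, ha'⟩
  lift B to ℝ using ⟨hb, hb'⟩
  simp only [EReal.coe_le_coe_iff] at hxA hyB hA hB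
  rw [ugDiff_coe, ENNReal.ofReal_le_iff_le_toReal hc, abs_sub_le_iff]
  have h₁ := hA (B + c.toReal) fun i => by linarith [hyB i, (abs_le.mp (hxy i)).2]
  have h₂ := hB (A + c.toReal) fun i => by linarith [hxA i, (abs_le.mp (hxy i)).1]
  constructor <;> linarith

theorem Curve.integral_mono (γ : Curve X) {g h : X → ℝ≥0∞} (hgh : g ≤ h) :
    γ.integral g ≤ γ.integral h :=
  lintegral_mono fun _ => hgh _

theorem UGOn.mono {f : X → EReal} {g h : X → ℝ≥0∞} {γ : Curve X} (hf : UGOn f g γ)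
    (hgh : g ≤ h) : UGOn f h γ :=
  le_trans hf (γ.integral_mono hgh)

theorem ZeroModulus.mono {p : ℝ} {μ : Measure X} {Γ Γ' : Set (Curve X)}
    (h : ZeroModulus p μ Γ') (hΓ : Γ ⊆ Γ') : ZeroModulus p μ Γ :=
  let ⟨ρ, hρ, hfin, htop⟩ := h
  ⟨ρ, hρ, hfin, fun γ hγ => htop γ (hΓ hγ)⟩

theorem ZeroModulus.iUnion {p : ℝ} (hp : 0 < p) {μ : Measure X} {ι : Type*} [Countable ι]
    {Γ : ι → Set (Curve X)} (h : ∀ i, ZeroModulus p μ (Γ i)) :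
    ZeroModulus p μ (⋃ i, Γ i) := by
  choose ρ hρ hfin htop using h
  obtain ⟨δ, hδ, hsum⟩ := ENNReal.exists_pos_tsum_mul_lt_of_countable one_ne_zero
    (fun i => ∫⁻ x, ρ i x ^ p ∂μ) fun i => (hfin i).ne
  have hδp : ∀ i, (δ i : ℝ≥0∞) ^ p⁻¹ ≠ ⊤ := fun i =>
    ENNReal.rpow_ne_top_of_nonneg (inv_nonneg.mpr hp.le) ENNReal.coe_ne_top
  have hδ0 : ∀ i, (δ i : ℝ≥0∞) ^ p⁻¹ ≠ 0 := fun i =>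
    (ENNReal.rpow_pos (ENNReal.coe_pos.mpr (hδ i)) ENNReal.coe_ne_top).ne'
  refine ⟨fun x => ⨆ i, (δ i : ℝ≥0∞) ^ p⁻¹ * ρ i x,
    .iSup fun i => (hρ i).const_mul _, ?_, fun γ hγ => ?_⟩
  · calc ∫⁻ x, (⨆ i, (δ i : ℝ≥0∞) ^ p⁻¹ * ρ i x) ^ p ∂μ
        ≤ ∫⁻ x, ∑' i, ρ i x ^ p * δ i ∂μ := lintegral_mono fun x => by
          refine (ENNReal.le_rpow_inv_iff hp).mp (iSup_le fun i => ?_)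
          rw [ENNReal.le_rpow_inv_iff hp, ENNReal.mul_rpow_of_nonneg _ _ hp.le,
            ENNReal.rpow_inv_rpow hp.ne', mul_comm]
          exact ENNReal.le_tsum (f := fun i => ρ i x ^ p * (δ i : ℝ≥0∞)) i
      _ = ∑' i, (∫⁻ x, ρ i x ^ p ∂μ) * δ i := by
          rw [lintegral_tsum fun i => (((hρ i).pow_const p).mul_const _).aemeasurable]
          exact tsum_congr fun i => lintegral_mul_const _ ((hρ i).pow_const p)
      _ < ⊤ := hsum.trans ENNReal.one_lt_top
  · obtain ⟨i, hi⟩ := mem_iUnion.mp hγ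
    have hscale : γ.integral (fun x => (δ i : ℝ≥0∞) ^ p⁻¹ * ρ i x) = ⊤ := by
      have := htop i γ hi
      rw [Curve.integral] at this ⊢
      rw [lintegral_const_mul' _ _ (hδp i), this, ENNReal.mul_top (hδ0 i)]
    refine top_le_iff.mp (hscale ▸ γ.integral_mono fun x => ?_)
    exact le_iSup (fun i => (δ i : ℝ≥0∞) ^ p⁻¹ * ρ i x) i

/-- If `uᵢ ≤ M` have `p`-weak upper gradients `gᵢ`, then `sup gᵢ` is a
`p`-weak upper gradient of `sup uᵢ`. -/
theorem stmt_9 (p : ℝ) (hp : 1 ≤ p) (μ : Measure X)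
    (hball : ∀ (x : X) (r : ℝ), 0 < r → 0 < μ (Metric.ball x r) ∧ μ (Metric.ball x r) < ⊤)
    (u : ℕ → X → EReal) (g : ℕ → X → ℝ≥0∞) (M : ℝ)
    (hM : ∀ i x, u i x ≤ (M : EReal))
    (hg : ∀ i, IsWeakUpperGradient p μ (u i) (g i)) :
    IsWeakUpperGradient p μ (fun x => ⨆ i, u i x) (fun x => ⨆ i, g i x) := by
  have hlt : ∀ x, ⨆ i, u i x ≠ ⊤ := fun x =>
    ((iSup_le fun i => hM i x).trans_lt (EReal.coe_lt_top M)).ne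
  refine ⟨.iSup fun i => (hg i).1,
    (ZeroModulus.iUnion (zero_lt_one.trans_le hp) fun i => (hg i).2).mono fun γ hγ => ?_⟩
  by_contra hmem
  simp only [mem_iUnion, mem_ofPred_eq, not_exists, not_not] at hmem
  exact hγ (ugDiff_iSup_le (hlt _) (hlt _) fun i =>
    (hmem i).mono fun x => le_iSup (fun i => g i x) i)

end
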